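/- Let A be a ring and Ã = [[A,0],[S̄,Ā]] its asymmetric cover. Then Fin.dim Ã^op = 0 if and only if A is left perfect. -/

import Mathlib

set_option linter.unusedSectionVars false
set_option synthInstance.maxHeartbeats 1000000
set_option maxHeartbeats 1600000
set_option linter.unusedVariables false
set_option linter.unnecessarySeqFocus false

universe u
open MulOpposite Function DirectSum

/-! ### Lower triangular matrix rings -/

/-- The lower triangular matrix ring `[[A,0],[M,B]]` for a `B`-`A`-bimodule `M`
(a left `B`-module with a commuting right `A`-action, the latter written as a
left `Aᵐᵒᵖ`-action). The element `⟨a, m, b⟩` represents the matrix `[[a,0],[m,b]]`. -/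
@[ext] structure Tri (A B M : Type u) : Type u where
  a : A
  m : M
  b : B

namespace Tri
variable {A B M : Type u} [Ring A] [Ring B] [AddCommGroup M]
  [Module B M] [Module Aᵐᵒᵖ M] [SMulCommClass B Aᵐᵒᵖ M]

instance : Zero (Tri A B M) := ⟨⟨0, 0, 0⟩⟩
instance : Add (Tri A B M) := ⟨fun x y => ⟨x.a + y.a, x.m + y.m, x.b + y.b⟩⟩
instance : Neg (Tri A B M) := ⟨fun x => ⟨-x.a, -x.m, -x.b⟩⟩
instance : One (Tri A B M) := ⟨⟨1, 0, 1⟩⟩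
instance : Mul (Tri A B M) :=
  ⟨fun x y => ⟨x.a * y.a, op y.a • x.m + x.b • y.m, x.b * y.b⟩⟩

@[simp] lemma zero_a : (0 : Tri A B M).a = 0 := rfl
@[simp] lemma zero_m : (0 : Tri A B M).m = 0 := rfl
@[simp] lemma zero_b : (0 : Tri A B M).b = 0 := rfl
@[simp] lemma add_a (x y : Tri A B M) : (x + y).a = x.a + y.a := rfl
@[simp] lemma add_m (x y : Tri A B M) : (x + y).m = x.m + y.m := rfl
@[simp] lemma add_b (x y : Tri A B M) : (x + y).b = x.b + y.b := rfl
@[simp] lemma neg_a (x : Tri A B M) : (-x).a = -x.a := rfl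
@[simp] lemma neg_m (x : Tri A B M) : (-x).m = -x.m := rfl
@[simp] lemma neg_b (x : Tri A B M) : (-x).b = -x.b := rfl
@[simp] lemma one_a : (1 : Tri A B M).a = 1 := rfl
@[simp] lemma one_m : (1 : Tri A B M).m = 0 := rfl
@[simp] lemma one_b : (1 : Tri A B M).b = 1 := rfl
@[simp] lemma mul_a (x y : Tri A B M) : (x * y).a = x.a * y.a := rfl
@[simp] lemma mul_m (x y : Tri A B M) : (x * y).m = op y.a • x.m + x.b • y.m := rfl
@[simp] lemma mul_b (x y : Tri A B M) : (x * y).b = x.b * y.b := rfl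

instance : AddCommGroup (Tri A B M) where
  add_assoc x y z := by ext <;> simp [add_assoc]
  zero_add x := by ext <;> simp
  add_zero x := by ext <;> simp
  add_comm x y := by ext <;> simp [add_comm]
  neg_add_cancel x := by ext <;> simp
  nsmul := nsmulRec
  zsmul := zsmulRec

instance : Ring (Tri A B M) :=
  { (inferInstance : AddCommGroup (Tri A B M)),
    (inferInstance : Mul (Tri A B M)),
    (inferInstance : One (Tri A B M)) with
    left_distrib := fun x y z => by
      ext <;> simp [mul_add, smul_add, add_smul] <;> abel
    right_distrib := fun x y z => by
      ext <;> simp [add_mul, smul_add, add_smul] <;> abel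
    zero_mul := fun x => by ext <;> simp
    mul_zero := fun x => by ext <;> simp
    mul_assoc := fun x y z => by
      refine Tri.ext (mul_assoc _ _ _) ?_ (mul_assoc _ _ _)
      simp only [mul_m, mul_b, mul_a, smul_add, op_mul, mul_smul]
      rw [smul_comm x.b (op z.a) y.m]
      abel
    one_mul := fun x => by ext <;> simp
    mul_one := fun x => by ext <;> simp }

end Tri

/-! ### Corner rings -/

/-- The corner ring `eΛe` of a ring `Λ` at an idempotent `e`, with unit `e`. -/
def Corner {Λ : Type u} [Ring Λ] (e : Λ) (_ : IsIdempotentElem e) : Type u :=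
  {x : Λ // e * x = x ∧ x * e = x}

namespace Corner
variable {Λ : Type u} [Ring Λ] {e : Λ} {he : IsIdempotentElem e}

instance : Zero (Corner e he) := ⟨⟨0, by simp, by simp⟩⟩
instance : Add (Corner e he) :=
  ⟨fun x y => ⟨x.1 + y.1, by rw [mul_add, x.2.1, y.2.1], by rw [add_mul, x.2.2, y.2.2]⟩⟩
instance : Neg (Corner e he) :=
  ⟨fun x => ⟨-x.1, by rw [mul_neg, x.2.1], by rw [neg_mul, x.2.2]⟩⟩
instance : Mul (Corner e he) :=
  ⟨fun x y => ⟨x.1 * y.1, by rw [← mul_assoc, x.2.1], by rw [mul_assoc, y.2.2]⟩⟩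
instance : One (Corner e he) := ⟨⟨e, he, he⟩⟩

instance : Ring (Corner e he) where
  add_assoc x y z := Subtype.ext (add_assoc _ _ _)
  zero_add x := Subtype.ext (zero_add _)
  add_zero x := Subtype.ext (add_zero _)
  add_comm x y := Subtype.ext (add_comm _ _)
  neg_add_cancel x := Subtype.ext (neg_add_cancel _)
  nsmul := nsmulRec
  zsmul := zsmulRec
  left_distrib x y z := Subtype.ext (mul_add _ _ _)
  right_distrib x y z := Subtype.ext (add_mul _ _ _)
  zero_mul x := Subtype.ext (zero_mul _)
  mul_zero x := Subtype.ext (mul_zero _)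
  mul_assoc x y z := Subtype.ext (mul_assoc _ _ _)
  one_mul x := Subtype.ext x.2.1
  mul_one x := Subtype.ext x.2.2

end Corner

/-! ### Projective dimension and finitistic dimensions -/

/-- `pdLE R n M` : `M` has projective dimension at most `n` as a left `R`-module. -/
def pdLE (R : Type u) [Ring R] : (n : ℕ) → (M : Type u) → [AddCommGroup M] → [Module R M] → Prop
  | 0, M, _, _ => Module.Projective R M
  | n+1, M, _, _ => ∃ (P : Type u) (_ : AddCommGroup P) (_ : Module R P),
      Module.Projective R P ∧
      ∃ f : P →ₗ[R] M, Function.Surjective f ∧ pdLE R n (LinearMap.ker f)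

/-- The projective dimension of a left `R`-module, as an element of `ℕ∞`
(with value `⊤` when no finite projective resolution exists). -/
noncomputable def projDim (R : Type u) [Ring R] (M : Type u) [AddCommGroup M] [Module R M] : ℕ∞ :=
  sInf {d : ℕ∞ | ∃ n : ℕ, d = n ∧ pdLE R n M}

/-- `fgpdLE R n M` : `M` admits a resolution of length at most `n` by finitely
generated projective left `R`-modules. -/
def fgpdLE (R : Type u) [Ring R] :
    (n : ℕ) → (M : Type u) → [AddCommGroup M] → [Module R M] → Prop
  | 0, M, _, _ => Module.Projective R M ∧ Module.Finite R M
  | n+1, M, _, _ => ∃ (P : Type u) (_ : AddCommGroup P) (_ : Module R P),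
      (Module.Projective R P ∧ Module.Finite R P) ∧
      ∃ f : P →ₗ[R] M, Function.Surjective f ∧ fgpdLE R n (LinearMap.ker f)

/-- The small finitistic dimension of `R`, computed with *left* `R`-modules: the
supremum of the projective dimensions of the left modules admitting a finite
resolution by finitely generated projectives. -/
noncomputable def smallFinDimLeft (R : Type u) [Ring R] : ℕ∞ :=
  sSup {d : ℕ∞ | ∃ (M : Type u) (_ : AddCommGroup M) (_ : Module R M),
    (∃ n : ℕ, fgpdLE R n M) ∧ projDim R M = d}

/-- The big finitistic dimension of `R`, computed with *left* `R`-modules: the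
supremum of all finite projective dimensions of left `R`-modules. -/
noncomputable def bigFinDimLeft (R : Type u) [Ring R] : ℕ∞ :=
  sSup {d : ℕ∞ | d ≠ ⊤ ∧ ∃ (M : Type u) (_ : AddCommGroup M) (_ : Module R M),
    projDim R M = d}

/-- `fin.dim R` : the small finitistic dimension of `R`, computed with right
`R`-modules (= left `Rᵐᵒᵖ`-modules). -/
noncomputable def finDim (R : Type u) [Ring R] : ℕ∞ := smallFinDimLeft Rᵐᵒᵖ

/-- `Fin.dim R` : the big finitistic dimension of `R`, computed with right
`R`-modules (= left `Rᵐᵒᵖ`-modules). -/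
noncomputable def bigFinDim (R : Type u) [Ring R] : ℕ∞ := bigFinDimLeft Rᵐᵒᵖ

/-! ### Radical, socle, perfect and semilocal rings, Morita equivalence -/

/-- The radical of a module: the intersection of all maximal submodules. -/
def moduleRad (R M : Type u) [Ring R] [AddCommGroup M] [Module R M] : Submodule R M :=
  sInf {N : Submodule R M | IsCoatom N}

/-- The socle of a module: the sum of all simple submodules. -/
def moduleSoc (R M : Type u) [Ring R] [AddCommGroup M] [Module R M] : Submodule R M :=
  sSup {N : Submodule R M | IsSimpleModule R ↥N}

/-- A ring is right perfect if every right module has a projective cover,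
i.e. a superfluous epimorphism from a projective module. -/
def IsRightPerfect (R : Type u) [Ring R] : Prop :=
  ∀ (M : Type u) (_ : AddCommGroup M) (_ : Module Rᵐᵒᵖ M),
    ∃ (P : Type u) (_ : AddCommGroup P) (_ : Module Rᵐᵒᵖ P) (f : P →ₗ[Rᵐᵒᵖ] M),
      Module.Projective Rᵐᵒᵖ P ∧ Function.Surjective f ∧
      ∀ N : Submodule Rᵐᵒᵖ P, N ⊔ LinearMap.ker f = ⊤ → N = ⊤

/-- A ring is left perfect if every left module has a projective cover. -/
def IsLeftPerfect (R : Type u) [Ring R] : Prop :=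
  ∀ (M : Type u) (_ : AddCommGroup M) (_ : Module R M),
    ∃ (P : Type u) (_ : AddCommGroup P) (_ : Module R P) (f : P →ₗ[R] M),
      Module.Projective R P ∧ Function.Surjective f ∧
      ∀ N : Submodule R P, N ⊔ LinearMap.ker f = ⊤ → N = ⊤

/-- A ring is semilocal if its quotient by the Jacobson radical is semisimple;
equivalently, there is a surjective ring homomorphism onto a semisimple ring
whose kernel is the Jacobson radical. -/
def IsSemilocal (A : Type u) [Ring A] : Prop :=
  ∃ (T : Type u) (_ : Ring T) (f : A →+* T), Function.Surjective f ∧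
    IsSemisimpleRing T ∧ RingHom.ker f = (⊥ : Ideal A).jacobson

/-- Morita equivalence, via the categories of right modules. -/
def MoritaEquiv (R S : Type u) [Ring R] [Ring S] : Prop :=
  Nonempty (ModuleCat.{u} Rᵐᵒᵖ ≌ ModuleCat.{u} Sᵐᵒᵖ)

/-- Powers of an additive subgroup of a ring (e.g. of the Jacobson radical of a
not necessarily commutative ring), defined via products. -/
def addSubgroupPow {R : Type u} [Ring R] (I : AddSubgroup R) : ℕ → AddSubgroup R
  | 0 => ⊤
  | 1 => I
  | n+2 => AddSubgroup.closure {x : R | ∃ p ∈ I, ∃ q ∈ addSubgroupPow I (n+1), x = p * q}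

/-- Left multiplication by a fixed element, as an endomorphism of the right
regular module. -/
def leftMulHom (R : Type u) [Ring R] (z : R) : R →ₗ[Rᵐᵒᵖ] R where
  toFun x := z * x
  map_add' := mul_add z
  map_smul' r x := (mul_assoc z x r.unop).symm

/-! ### The asymmetric cover -/

/-- The endomorphism ring of the right `A`-module `S i`. -/
abbrev EndS (A : Type u) [Ring A] {ι : Type u} (S : ι → Type u)
    [∀ i, AddCommGroup (S i)] [∀ i, Module Aᵐᵒᵖ (S i)] (i : ι) : Type u :=
  Module.End Aᵐᵒᵖ (S i)

/-- `Ā = ∏_{S ∈ Σ(A)} T(End_A(S))`, the product over the simple right `A`-modules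
of the trivial extensions of their endomorphism rings. -/
abbrev Abar (A : Type u) [Ring A] {ι : Type u} (S : ι → Type u)
    [∀ i, AddCommGroup (S i)] [∀ i, Module Aᵐᵒᵖ (S i)] : Type u :=
  ∀ i, TrivSqZeroExt (EndS A S i) (EndS A S i)

/-- `S̄ = ⊕_{S ∈ Σ(A)} S`, the direct sum of the simple right `A`-modules. -/
abbrev Sbar (A : Type u) [Ring A] {ι : Type u} (S : ι → Type u)
    [∀ i, AddCommGroup (S i)] [∀ i, Module Aᵐᵒᵖ (S i)] : Type u :=
  ⨁ i, S i

/-- The canonical projection `T(B) → B` from a trivial extension, as a ring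
homomorphism. -/
def tszeFst (B : Type u) [Ring B] : TrivSqZeroExt B B →+* B where
  toFun x := x.fst
  map_one' := rfl
  map_mul' _ _ := rfl
  map_zero' := rfl
  map_add' _ _ := rfl

section
variable (A : Type u) [Ring A] {ι : Type u} (S : ι → Type u)
  [∀ i, AddCommGroup (S i)] [∀ i, Module Aᵐᵒᵖ (S i)]

/-- The left `Ā`-action on each simple module `S i`, via `Ā → T(End_A(S i)) → End_A(S i)`. -/
instance instModuleAbarS (i : ι) : Module (Abar A S) (S i) where
  smul r x := (r i).fst x
  one_smul x := rfl
  mul_smul r s x := rfl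
  smul_zero r := map_zero _
  smul_add r x y := map_add _ x y
  add_smul r s x := LinearMap.add_apply _ _ _
  zero_smul x := rfl

lemma abar_smul_def (r : Abar A S) (i : ι) (x : S i) : r • x = (r i).fst x := rfl

instance instSMulCommAbarS (i : ι) : SMulCommClass (Abar A S) Aᵐᵒᵖ (S i) where
  smul_comm r a x := map_smul ((r i).fst) a x

instance instSMulCommAbarSbar : SMulCommClass (Abar A S) Aᵐᵒᵖ (Sbar A S) where
  smul_comm r a x := by
    refine DFinsupp.ext fun i => ?_
    simp only [DirectSum.smul_apply]
    exact smul_comm _ _ _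

end

/-- The asymmetric cover `Ã = [[A,0],[S̄,Ā]]` of the ring `A`, relative to a
family `S : ι → Type u` of representatives of the simple right `A`-modules. -/
abbrev AsymCover (A : Type u) [Ring A] {ι : Type u} (S : ι → Type u)
    [∀ i, AddCommGroup (S i)] [∀ i, Module Aᵐᵒᵖ (S i)] : Type u :=
  Tri A (Abar A S) (Sbar A S)

/-- `S : ι → Type u` is a complete irredundant family of representatives of the
isomorphism classes of simple right `A`-modules. -/
def IsSimpleFamily (A : Type u) [Ring A] {ι : Type u} (S : ι → Type u)
    [∀ i, AddCommGroup (S i)] [∀ i, Module Aᵐᵒᵖ (S i)] : Prop :=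
  (∀ i, IsSimpleModule Aᵐᵒᵖ (S i)) ∧
  (∀ (T : Type u) (_ : AddCommGroup T) (_ : Module Aᵐᵒᵖ T),
    IsSimpleModule Aᵐᵒᵖ T → ∃ i, Nonempty (T ≃ₗ[Aᵐᵒᵖ] S i)) ∧
  (∀ i j, Nonempty (S i ≃ₗ[Aᵐᵒᵖ] S j) → i = j)

/-! ### The Jacobson radical -/

section Radical

variable {R : Type u} [Ring R]

/-- If `1 + x * y` is a unit then so is `1 + y * x`. -/
lemma isUnit_one_add_mul_comm {x y : R} (h : IsUnit (1 + x * y)) : IsUnit (1 + y * x) := by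
  obtain ⟨u, hu⟩ := h
  have h1 : (1 + x * y) * (↑u⁻¹ : R) = 1 := by rw [← hu, Units.mul_inv]
  have h2 : (↑u⁻¹ : R) * (1 + x * y) = 1 := by rw [← hu, Units.inv_mul]
  refine isUnit_iff_exists.2 ⟨1 - y * ↑u⁻¹ * x, ?_, ?_⟩
  · calc (1 + y * x) * (1 - y * ↑u⁻¹ * x)
        = 1 + y * x - y * ((1 + x * y) * ↑u⁻¹) * x := by noncomm_ring
      _ = 1 := by rw [h1]; noncomm_ring
  · calc (1 - y * ↑u⁻¹ * x) * (1 + y * x)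
        = 1 + y * x - y * (↑u⁻¹ * (1 + x * y)) * x := by noncomm_ring
      _ = 1 := by rw [h2]; noncomm_ring

/-- Membership in the Jacobson radical, in terms of units. -/
lemma mem_ringJacobson_iff {x : R} : x ∈ Ring.jacobson R ↔ ∀ y : R, IsUnit (1 + y * x) := by
  rw [Ring.jacobson_eq_sInf_isMaximal, Submodule.mem_sInf]
  have key (h : ∀ I ∈ {I : Ideal R | I.IsMaximal}, x ∈ I) (y : R) : ∃ u, u * (1 + y * x) = 1 := by
    have htop : Ideal.span {1 + y * x} = ⊤ := by
      by_contra hne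
      obtain ⟨m, hm, hle⟩ := Ideal.exists_le_maximal _ hne
      refine hm.ne_top ((Ideal.eq_top_iff_one m).2 ?_)
      have h1 : 1 + y * x ∈ m := hle (Ideal.mem_span_singleton_self _)
      simpa using m.sub_mem h1 (m.mul_mem_left y (h m hm))
    exact Ideal.mem_span_singleton'.1 (htop ▸ Submodule.mem_top)
  constructor
  · intro h y
    obtain ⟨u, hu⟩ := key h y
    obtain ⟨v, hv⟩ := key h (-(u * y))
    have hu' : 1 + -(u * y) * x = u := by
      rw [← hu]; noncomm_ring
    rw [hu'] at hv
    have : v = 1 + y * x := left_inv_eq_right_inv hv hu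
    exact isUnit_iff_exists.2 ⟨u, this ▸ hv, hu⟩
  · intro h (m : Ideal R) (hm : m.IsMaximal)
    by_contra hx
    obtain ⟨y, z, hz, hyz⟩ := hm.exists_inv hx
    refine hm.ne_top (Ideal.eq_top_of_isUnit_mem m ?_ (h (-y)))
    rwa [show 1 + -y * x = z by rw [← hyz]; noncomm_ring]

lemma op_mem_ringJacobson_iff {x : R} : op x ∈ Ring.jacobson Rᵐᵒᵖ ↔ x ∈ Ring.jacobson R := by
  rw [mem_ringJacobson_iff, mem_ringJacobson_iff]
  constructor
  · intro h y
    have := (h (op y)).unop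
    exact isUnit_one_add_mul_comm (by simpa using this)
  · intro h y
    have := (isUnit_one_add_mul_comm (h y.unop)).op
    simpa using this

end Radical

/-! ### Ideals acting on projective modules -/

section Projective

variable {R : Type u} [Ring R] {M : Type u} [AddCommGroup M] [Module R M]

lemma map_mem_of_mem_smul_top {I : Ideal R} [I.IsTwoSided] (φ : M →ₗ[R] R) {y : M}
    (hy : y ∈ I • (⊤ : Submodule R M)) : φ y ∈ I := by
  refine Submodule.smul_induction_on hy (fun r hr n _ => ?_) (fun a b ha hb => ?_)
  · rw [map_smul]
    exact I.mul_mem_right _ hr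
  · rw [map_add]
    exact I.add_mem ha hb

lemma mem_smul_top_of_forall_map_mem {I : Ideal R} [Module.Projective R M] {y : M}
    (h : ∀ φ : M →ₗ[R] R, φ y ∈ I) : y ∈ I • (⊤ : Submodule R M) := by
  obtain ⟨s, hs⟩ := Module.projective_def'.1 ‹Module.Projective R M›
  have hy : Finsupp.linearCombination R id (s y) = y := LinearMap.congr_fun hs y
  rw [← hy, Finsupp.linearCombination_apply]
  exact Submodule.sum_mem _ fun j _ =>
    Submodule.smul_mem_smul (h (Finsupp.lapply j ∘ₗ s)) Submodule.mem_top

/-- A nonzero projective module `P` satisfies `JP ≠ P`. -/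
lemma subsingleton_of_jacobson_smul_eq_top [Module.Projective R M]
    (h : Ring.jacobson R • (⊤ : Submodule R M) = ⊤) : Subsingleton M := by
  obtain ⟨s, hs⟩ := Module.projective_def'.1 ‹Module.Projective R M›
  refine subsingleton_of_forall_eq 0 fun x => ?_
  have hx : Finsupp.linearCombination R id (s x) = x := LinearMap.congr_fun hs x
  let N : Submodule Rᵐᵒᵖ R := Submodule.span Rᵐᵒᵖ ((s x) '' (s x).support)
  have hN : N = ⊥ := by
    refine Submodule.FG.eq_bot_of_le_jacobson_smul
      (Submodule.fg_span ((s x).support.finite_toSet.image _)) (Submodule.span_le.2 ?_)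
    rintro _ ⟨k, -, rfl⟩
    have hk : s x k = (s x).sum fun j r => op (s j k) • r := by
      conv_lhs => rw [← hx, Finsupp.linearCombination_apply, map_finsuppSum,
        Finsupp.sum_apply]
      simp
    rw [SetLike.mem_coe, hk]
    refine Submodule.sum_mem _ fun j hj => Submodule.smul_mem_smul ?_
      (Submodule.subset_span ⟨j, hj, rfl⟩)
    rw [op_mem_ringJacobson_iff]
    exact map_mem_of_mem_smul_top (Finsupp.lapply k ∘ₗ s) (by rw [h]; exact Submodule.mem_top)
  have hz : s x = 0 := by
    ext k
    by_contra hk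
    have : s x k ∈ N := Submodule.subset_span ⟨k, by simpa using hk, rfl⟩
    rw [hN] at this
    exact hk (by simpa using this)
  rw [← hx, hz, map_zero]

/-- Superfluous submodules of a projective module lie in its radical `JP`. -/
lemma le_jacobson_smul_top_of_superfluous [Module.Projective R M] {L : Submodule R M}
    (hL : ∀ N : Submodule R M, N ⊔ L = ⊤ → N = ⊤) : L ≤ Ring.jacobson R • ⊤ := by
  intro y hy
  refine mem_smul_top_of_forall_map_mem fun φ => ?_
  rw [Ring.jacobson, Module.jacobson, Submodule.mem_sInf]
  intro m hm
  rcases Submodule.isCoatom_comap_or_eq_top φ hm with h | h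
  · by_contra hn
    refine h.1 (hL _ (h.2 _ ?_))
    refine lt_of_le_of_ne le_sup_left fun he => hn ?_
    have : y ∈ m.comap φ := by rw [he]; exact Submodule.mem_sup_right hy
    exact this
  · have : y ∈ m.comap φ := h ▸ Submodule.mem_top
    exact this

end Projective

/-! ### Nakayama's lemma for arbitrary modules -/

/-- Nakayama's lemma for an ideal `I` and arbitrary left modules: `IM = M` implies `M = 0`. -/
def NakayamaIdeal {R : Type u} [Ring R] (I : Ideal R) : Prop :=
  ∀ (M : Type u) [AddCommGroup M] [Module R M], I • (⊤ : Submodule R M) = ⊤ → Subsingleton M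

section Nakayama

variable {R : Type u} [Ring R] {I : Ideal R}

lemma NakayamaIdeal.eq_top (hI : NakayamaIdeal I) {M : Type u} [AddCommGroup M] [Module R M]
    {N : Submodule R M} (h : N ⊔ I • ⊤ = ⊤) : N = ⊤ := by
  rw [← Submodule.Quotient.subsingleton_iff]
  refine hI (M ⧸ N) ?_
  have h1 : (⊤ : Submodule R M).map N.mkQ = ⊤ := by
    rw [Submodule.map_top, LinearMap.range_eq_top.2 N.mkQ_surjective]
  have h2 := congrArg (Submodule.map N.mkQ) h
  rwa [Submodule.map_sup, Submodule.mkQ_map_self, bot_sup_eq, Submodule.map_smul'', h1] at h2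

lemma isSemisimpleModule_quotient_smul_top [I.IsTwoSided] [IsSemisimpleRing (R ⧸ I)]
    (M : Type u) [AddCommGroup M] [Module R M] :
    IsSemisimpleModule R (M ⧸ I • (⊤ : Submodule R M)) :=
  (Module.isTorsionBySet_quotient_ideal_smul M I).isSemisimpleModule_iff.mp
    (letI := (Module.isTorsionBySet_quotient_ideal_smul M I).module; inferInstance)

/-- If `R / I` is semisimple, `I` satisfies Nakayama's lemma, and `I` contains the right
annihilator of its left annihilator, then monomorphisms between projectives split. -/
lemma exists_retraction_of_injective [I.IsTwoSided] [IsSemisimpleRing (R ⧸ I)]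
    (hI : NakayamaIdeal I) (hann : ∀ y : R, (∀ x : R, (∀ z ∈ I, x * z = 0) → x * y = 0) → y ∈ I)
    {K P : Type u} [AddCommGroup K] [Module R K] [AddCommGroup P] [Module R P]
    [Module.Projective R K] [Module.Projective R P] (i : K →ₗ[R] P) (hi : Injective i) :
    ∃ g : P →ₗ[R] K, g ∘ₗ i = LinearMap.id := by
  have hle : I • (⊤ : Submodule R K) ≤ (I • (⊤ : Submodule R P)).comap i := by
    rw [← Submodule.map_le_iff_le_comap, Submodule.map_smul'']
    exact smul_mono_right _ le_top
  let j := Submodule.mapQ (I • (⊤ : Submodule R K)) (I • (⊤ : Submodule R P)) i hle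
  have hj : Injective j := by
    rw [← LinearMap.ker_eq_bot, LinearMap.ker_eq_bot']
    intro q hq
    obtain ⟨k, rfl⟩ := Submodule.mkQ_surjective _ q
    have hk : i k ∈ I • (⊤ : Submodule R P) := by
      rwa [Submodule.mkQ_apply, Submodule.mapQ_apply, Submodule.Quotient.mk_eq_zero] at hq
    rw [Submodule.mkQ_apply, Submodule.Quotient.mk_eq_zero]
    refine mem_smul_top_of_forall_map_mem fun φ => hann _ fun x hx => ?_
    have hxk : x • k = 0 := by
      refine hi ?_
      rw [map_smul, map_zero]
      refine Submodule.smul_induction_on hk (fun r hr n _ => ?_) (fun a b ha hb => ?_)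
      · rw [← mul_smul, hx r hr, zero_smul]
      · rw [smul_add, ha, hb, add_zero]
    rw [← smul_eq_mul, ← map_smul, hxk, map_zero]
  have := isSemisimpleModule_quotient_smul_top (I := I) P
  obtain ⟨ρ, hρ⟩ := IsSemisimpleModule.extension_property j hj LinearMap.id
  obtain ⟨g, hg⟩ := Module.projective_lifting_property
    (I • (⊤ : Submodule R K)).mkQ (ρ ∘ₗ (I • (⊤ : Submodule R P)).mkQ) (Submodule.mkQ_surjective _)
  have hgi (k : K) : k - g (i k) ∈ I • (⊤ : Submodule R K) := by
    rw [← Submodule.Quotient.eq]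
    have h1 := LinearMap.congr_fun hg (i k)
    have h2 := LinearMap.congr_fun hρ ((I • (⊤ : Submodule R K)).mkQ k)
    simp only [LinearMap.comp_apply, LinearMap.id_apply] at h1 h2
    exact (h1.trans h2).symm
  have surj (h : K →ₗ[R] K) (hh : ∀ k, k - h k ∈ I • (⊤ : Submodule R K)) : Surjective h := by
    rw [← LinearMap.range_eq_top]
    refine hI.eq_top (eq_top_iff.2 fun k _ => ?_)
    rw [← add_sub_cancel (h k) k]
    exact Submodule.add_mem_sup (LinearMap.mem_range_self h k) (hh k)
  obtain ⟨s, hs⟩ := Module.projective_lifting_property (g ∘ₗ i) LinearMap.id (surj _ hgi)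
  have hs' (k : K) : g (i (s k)) = k := LinearMap.congr_fun hs k
  have hss : Surjective s := surj s fun k => by
    have := Submodule.neg_mem _ (hgi (s k))
    rwa [hs', neg_sub] at this
  refine ⟨s ∘ₗ g, LinearMap.ext fun k => ?_⟩
  obtain ⟨k, rfl⟩ := hss k
  simp [hs']

end Nakayama

/-! ### Perfect rings: radical and semisimple quotient -/

section Perfect

variable {R : Type u} [Ring R]

lemma IsLeftPerfect.nakayamaIdeal (hR : IsLeftPerfect R) : NakayamaIdeal (Ring.jacobson R) := by
  intro M _ _ hM
  obtain ⟨P, _, _, f, _, hf, hsmall⟩ := hR M _ _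
  have hker := le_jacobson_smul_top_of_superfluous hsmall
  have htop : Ring.jacobson R • (⊤ : Submodule R P) = ⊤ := by
    have h1 : (Ring.jacobson R • (⊤ : Submodule R P)).map f = ⊤ := by
      rw [Submodule.map_smul'', Submodule.map_top, LinearMap.range_eq_top.2 hf, hM]
    have h2 := Submodule.comap_map_eq f (Ring.jacobson R • (⊤ : Submodule R P))
    rw [h1, Submodule.comap_top, sup_eq_left.2 hker] at h2
    exact h2.symm
  have := subsingleton_of_jacobson_smul_eq_top htop
  exact hf.subsingleton

/-- Over a left perfect ring, every left ideal has a complement modulo the radical. -/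
lemma IsLeftPerfect.exists_sup_eq_top_inf_le (hR : IsLeftPerfect R) (L : Ideal R) :
    ∃ L' : Ideal R, L ⊔ L' = ⊤ ∧ L ⊓ L' ≤ Ring.jacobson R := by
  obtain ⟨P, _, _, f, _, hf, hsmall⟩ := hR (R ⧸ L) _ _
  obtain ⟨g, hg⟩ := Module.projective_lifting_property f L.mkQ hf
  have hgs : Surjective g := by
    rw [← LinearMap.range_eq_top]
    refine hsmall _ (eq_top_iff.2 fun p _ => ?_)
    obtain ⟨r, hr⟩ := Submodule.mkQ_surjective L (f p)
    rw [← add_sub_cancel (g r) p]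
    refine Submodule.add_mem_sup (LinearMap.mem_range_self g r) ?_
    rw [LinearMap.mem_ker, map_sub, ← hr, ← LinearMap.comp_apply, hg, sub_self]
  obtain ⟨s, hs⟩ := Module.projective_lifting_property g LinearMap.id hgs
  have hs' (p : P) : g (s p) = p := LinearMap.congr_fun hs p
  have hfg (r : R) : f (g r) = L.mkQ r := LinearMap.congr_fun hg r
  refine ⟨LinearMap.range s, eq_top_iff.2 fun r _ => ?_, ?_⟩
  · rw [← sub_add_cancel r (s (g r))]
    refine Submodule.add_mem_sup ?_ (LinearMap.mem_range_self s _)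
    rw [← Submodule.Quotient.mk_eq_zero, ← Submodule.mkQ_apply, ← hfg, map_sub, hs', sub_self,
      map_zero]
  · rintro _ ⟨hr, p, rfl⟩
    refine map_mem_of_mem_smul_top s (le_jacobson_smul_top_of_superfluous hsmall ?_)
    rw [LinearMap.mem_ker, ← hs' p, hfg, Submodule.mkQ_apply, Submodule.Quotient.mk_eq_zero]
    exact hr

lemma IsLeftPerfect.isSemisimpleRing_quotient (hR : IsLeftPerfect R) :
    IsSemisimpleRing (R ⧸ Ring.jacobson R) := by
  refine (isSemisimpleModule_iff _ _).2 ⟨fun L => ?_⟩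
  let π := Ideal.Quotient.mk (Ring.jacobson R)
  have hπ : Surjective π := Ideal.Quotient.mk_surjective
  obtain ⟨L', htop, hbot⟩ := hR.exists_sup_eq_top_inf_le (Ideal.comap π L)
  refine ⟨Ideal.map π L', ?_, ?_⟩
  · rw [Submodule.disjoint_def]
    intro x hx hx'
    obtain ⟨y, hy, rfl⟩ := (Ideal.mem_map_iff_of_surjective π hπ).1 hx'
    exact Ideal.Quotient.eq_zero_iff_mem.2 (hbot ⟨hx, hy⟩)
  · rw [codisjoint_iff, ← Ideal.map_comap_of_surjective π hπ L, ← Ideal.map_sup, htop,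
      Ideal.map_top]

end Perfect


/-! ### Vanishing of the finitistic dimension -/

/-- Every monomorphism between projective left `R`-modules splits. -/
def ProjectiveMonoSplit (R : Type u) [Ring R] : Prop :=
  ∀ (K P : Type u) [AddCommGroup K] [Module R K] [AddCommGroup P] [Module R P]
    [Module.Projective R K] [Module.Projective R P] (i : K →ₗ[R] P), Injective i →
    ∃ g : P →ₗ[R] K, g ∘ₗ i = LinearMap.id

section FinitisticDimension

variable {R : Type u} [Ring R]

lemma pdLE.projective (hR : ProjectiveMonoSplit R) :
    ∀ (n : ℕ) (M : Type u) [AddCommGroup M] [Module R M], pdLE R n M → Module.Projective R M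
  | 0, _, _, _, h => h
  | n + 1, M, _, _, h => by
    obtain ⟨P, _, _, _, f, hf, hker⟩ := h
    have := pdLE.projective hR n _ hker
    obtain ⟨g, hg⟩ := hR _ _ (LinearMap.ker f).subtype (Submodule.injective_subtype _)
    have hex : Function.Exact (LinearMap.ker f).subtype f := by
      rw [LinearMap.exact_iff, Submodule.range_subtype]
    have hiff : (Surjective f ∧ ∃ l, l ∘ₗ (LinearMap.ker f).subtype = LinearMap.id) ↔
        (Injective (LinearMap.ker f).subtype ∧ ∃ l, f ∘ₗ l = LinearMap.id) :=
      hex.split_tfae'.out 1 0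
    obtain ⟨-, s, hs⟩ := hiff.1 ⟨hf, g, hg⟩
    exact Module.Projective.of_split s f hs

lemma projective_of_projDim_eq_zero {M : Type u} [AddCommGroup M] [Module R M]
    (h : projDim R M = 0) : Module.Projective R M := by
  have hne : {d : ℕ∞ | ∃ n : ℕ, d = n ∧ pdLE R n M}.Nonempty := by
    by_contra he
    rw [projDim, Set.not_nonempty_iff_eq_empty.1 he, sInf_empty] at h
    exact ENat.top_ne_zero h
  obtain ⟨n, hn, hpd⟩ := csInf_mem hne
  have h0 : n = 0 := by
    have h : sInf {d : ℕ∞ | ∃ n : ℕ, d = n ∧ pdLE R n M} = 0 := h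
    rw [h] at hn
    exact_mod_cast hn.symm
  subst h0
  exact hpd

lemma bigFinDimLeft_eq_zero_iff : bigFinDimLeft R = 0 ↔ ProjectiveMonoSplit R := by
  constructor
  · intro h K P _ _ _ _ _ _ i hi
    have hpd : pdLE R 1 (P ⧸ LinearMap.range i) := by
      refine ⟨P, _, _, inferInstance, (LinearMap.range i).mkQ, Submodule.mkQ_surjective _, ?_⟩
      exact Module.Projective.of_equiv
        ((LinearEquiv.ofInjective i hi).trans (LinearEquiv.ofEq _ _ (Submodule.ker_mkQ _).symm))
    have hle : projDim R (P ⧸ LinearMap.range i) ≤ 1 := sInf_le ⟨1, by simp, hpd⟩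
    have hle0 : projDim R (P ⧸ LinearMap.range i) ≤ bigFinDimLeft R :=
      le_sSup ⟨ne_top_of_le_ne_top (by simp) hle, _, _, _, rfl⟩
    have := projective_of_projDim_eq_zero (le_antisymm (hle0.trans h.le) bot_le)
    obtain ⟨s, hs⟩ := Module.projective_lifting_property (LinearMap.range i).mkQ LinearMap.id
      (Submodule.mkQ_surjective _)
    have hiff : (Injective i ∧ ∃ l, (LinearMap.range i).mkQ ∘ₗ l = LinearMap.id) ↔
        (Surjective (LinearMap.range i).mkQ ∧ ∃ l, l ∘ₗ i = LinearMap.id) :=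
      (LinearMap.exact_map_mkQ_range i).split_tfae'.out 0 1
    obtain ⟨-, g, hg⟩ := hiff.1 ⟨hi, s, hs⟩
    exact ⟨g, hg⟩
  · intro h
    refine le_antisymm (sSup_le ?_) bot_le
    rintro d ⟨hd, M, _, _, rfl⟩
    have hne : {d : ℕ∞ | ∃ n : ℕ, d = n ∧ pdLE R n M}.Nonempty := by
      by_contra he
      rw [projDim, Set.not_nonempty_iff_eq_empty.1 he, sInf_empty] at hd
      exact hd rfl
    obtain ⟨_, n, -, hn⟩ := hne
    exact sInf_le ⟨0, by simp, pdLE.projective h n M hn⟩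

lemma ProjectiveMonoSplit.of_ringEquiv {R' : Type u} [Ring R'] (e : R ≃+* R')
    (hR : ProjectiveMonoSplit R) : ProjectiveMonoSplit R' := by
  intro K P _ _ _ _ _ _ i hi
  let := RingHomInvPair.of_ringEquiv e
  let := RingHomInvPair.symm (e : R →+* R') (e.symm : R' →+* R)
  let : Module R K := Module.compHom K (e : R →+* R')
  let : Module R P := Module.compHom P (e : R →+* R')
  have hproj (N : Type u) [AddCommGroup N] [Module R' N] [Module.Projective R' N] :
      let : Module R N := Module.compHom N (e : R →+* R')
      Module.Projective R N := by
    let : Module R N := Module.compHom N (e : R →+* R')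
    let ε : N ≃ₛₗ[(e.symm : R' →+* R)] N :=
      { AddEquiv.refl N with
        map_smul' := fun r x => by
          change r • x = e (e.symm r) • x
          rw [e.apply_symm_apply] }
    exact Module.Projective.of_equiv ε
  have := hproj K
  have := hproj P
  let i' : K →ₗ[R] P :=
    { toFun := i, map_add' := map_add i, map_smul' := fun r x => map_smul i (e r) x }
  obtain ⟨g, hg⟩ := hR K P i' hi
  refine ⟨{ toFun := g, map_add' := map_add g, map_smul' := fun r x => ?_ },
    LinearMap.ext fun k => LinearMap.congr_fun hg k⟩
  have := map_smul g (e.symm r) x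
  change g (e (e.symm r) • x) = e (e.symm r) • g x at this
  rwa [e.apply_symm_apply] at this

lemma bigFinDim_mulOpposite_eq_zero_iff : bigFinDim Rᵐᵒᵖ = 0 ↔ ProjectiveMonoSplit R :=
  bigFinDimLeft_eq_zero_iff.trans
    ⟨.of_ringEquiv (RingEquiv.opOp R).symm, .of_ringEquiv (RingEquiv.opOp R)⟩

end FinitisticDimension

/-! ### Chains of principal right ideals -/

/-- The products `c 0 * c 1 * ⋯ * c (n - 1)`. -/
def seqProd {R : Type u} [Ring R] (c : ℕ → R) : ℕ → R
  | 0 => 1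
  | n + 1 => seqProd c n * c n

/-- Every chain `c 0 R ⊇ c 0 c 1 R ⊇ ⋯` of principal right ideals has a repetition. -/
def PrincipalRightChain (R : Type u) [Ring R] : Prop :=
  ∀ c : ℕ → R, ∃ (k : ℕ) (r : R), seqProd c (k + 1) = seqProd c (k + 2) * r

section Chains

variable {R : Type u} [Ring R]

lemma map_seqProd {R' : Type u} [Ring R'] (f : R →+* R') (c : ℕ → R) (n : ℕ) :
    f (seqProd c n) = seqProd (fun k => f (c k)) n := by
  induction n with
  | zero => exact map_one f
  | succ n ih => rw [seqProd, map_mul, ih, seqProd]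

lemma PrincipalRightChain.of_surjective {R' : Type u} [Ring R'] (f : R →+* R')
    (hf : Surjective f) (hR : PrincipalRightChain R) : PrincipalRightChain R' := by
  intro c
  choose d hd using fun n => hf (c n)
  obtain ⟨k, r, hk⟩ := hR d
  refine ⟨k, f r, ?_⟩
  have := congrArg f hk
  rw [map_mul, map_seqProd, map_seqProd] at this
  simpa only [hd] using this

/-- The map `e n ↦ c n • e (n + 1)` on the free module with basis `e 0, e 1, …`. -/
noncomputable def weightedShift (c : ℕ → R) : (ℕ →₀ R) →ₗ[R] (ℕ →₀ R) :=
  Finsupp.linearCombination R fun n => Finsupp.single (n + 1) (c n)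

lemma weightedShift_single (c : ℕ → R) (n : ℕ) (r : R) :
    weightedShift c (Finsupp.single n r) = Finsupp.single (n + 1) (r * c n) := by
  simp [weightedShift]

lemma weightedShift_apply_zero (c : ℕ → R) (x : ℕ →₀ R) : weightedShift c x 0 = 0 := by
  induction x using Finsupp.induction_linear with
  | zero => simp
  | add x y hx hy => simp [hx, hy]
  | single n r => simp [weightedShift_single]

lemma weightedShift_apply_succ (c : ℕ → R) (x : ℕ →₀ R) (n : ℕ) :
    weightedShift c x (n + 1) = x n * c n := by
  induction x using Finsupp.induction_linear with
  | zero => simp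
  | add x y hx hy => simp [hx, hy, add_mul]
  | single m r =>
    rw [weightedShift_single]
    by_cases h : m = n
    · subst h; simp
    · simp [h]

lemma ProjectiveMonoSplit.principalRightChain (hR : ProjectiveMonoSplit R) :
    PrincipalRightChain R := by
  intro c
  let i : (ℕ →₀ R) →ₗ[R] (ℕ →₀ R) := LinearMap.id - weightedShift c
  have hi : Injective i := by
    rw [← LinearMap.ker_eq_bot, LinearMap.ker_eq_bot']
    intro x hx
    have hx' (n : ℕ) : x n = weightedShift c x n := by
      have := DFunLike.congr_fun hx n
      simpa [i, sub_eq_zero] using this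
    ext n
    induction n with
    | zero => rw [hx', weightedShift_apply_zero, Finsupp.zero_apply]
    | succ n ih => rw [hx', weightedShift_apply_succ, ih]; simp
  obtain ⟨g, hg⟩ := hR (ℕ →₀ R) (ℕ →₀ R) i hi
  let y (n : ℕ) : ℕ →₀ R := g (Finsupp.single n 1)
  have hy (n : ℕ) : y n = Finsupp.single n 1 + c n • y (n + 1) := by
    have h1 : i (Finsupp.single n 1) = Finsupp.single n 1 - c n • Finsupp.single (n + 1) 1 := by
      simp [i, weightedShift_single]
    have h2 := LinearMap.congr_fun hg (Finsupp.single n 1)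
    rw [LinearMap.comp_apply, h1, map_sub, map_smul, LinearMap.id_apply] at h2
    exact sub_eq_iff_eq_add.1 h2
  have hy0 (n : ℕ) :
      y 0 = ∑ j ∈ Finset.range n, Finsupp.single j (seqProd c j) + seqProd c n • y n := by
    induction n with
    | zero => simp [seqProd]
    | succ n ih =>
      rw [ih, Finset.sum_range_succ, add_assoc]
      conv_lhs => rw [hy n, smul_add, ← mul_smul]
      simp [seqProd]
  obtain ⟨k, hk⟩ : ∃ k, y 0 (k + 1) = 0 := by
    obtain ⟨k, hk⟩ := Infinite.exists_notMem_finset ((y 0).support.image Nat.pred)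
    refine ⟨k, by_contra fun hne => hk (Finset.mem_image.2 ⟨k + 1, ?_, rfl⟩)⟩
    exact Finsupp.mem_support_iff.2 hne
  refine ⟨k, -y (k + 2) (k + 1), ?_⟩
  have h := DFunLike.congr_fun (hy0 (k + 2)) (k + 1)
  rw [hk, Finsupp.add_apply, Finsupp.finsetSum_apply, Finset.sum_eq_single (k + 1)
    (fun j _ hj => Finsupp.single_eq_of_ne hj.symm) (by simp), Finsupp.single_eq_same,
    Finsupp.smul_apply, smul_eq_mul] at h
  rw [mul_neg]
  exact eq_neg_of_add_eq_zero_left h.symm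

end Chains

/-! ### Bass' theorem -/

section Bass

variable {R : Type u} [Ring R]

lemma PrincipalRightChain.nakayamaIdeal (hR : PrincipalRightChain R) :
    NakayamaIdeal (Ring.jacobson R) := by
  intro M _ _ hM
  by_contra hne
  rw [not_subsingleton_iff_nontrivial] at hne
  obtain ⟨m, hm⟩ := exists_ne (0 : M)
  have step (p : {p : R // ∃ m : M, p • m ≠ 0}) :
      ∃ a ∈ Ring.jacobson R, ∃ m : M, (p.1 * a) • m ≠ 0 := by
    by_contra! h
    obtain ⟨m, hm⟩ := p.2
    refine hm ?_
    have hmem : m ∈ Ring.jacobson R • (⊤ : Submodule R M) := by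
      rw [hM]; exact Submodule.mem_top
    refine Submodule.smul_induction_on hmem (fun a ha n _ => ?_) (fun x y hx hy => ?_)
    · rw [← mul_smul, h a ha n]
    · rw [smul_add, hx, hy, add_zero]
  choose a ha hgood using step
  let p (n : ℕ) : {p : R // ∃ m : M, p • m ≠ 0} :=
    Nat.rec ⟨1, m, by rwa [one_smul]⟩ (fun _ p => ⟨p.1 * a p, hgood p⟩) n
  let c (n : ℕ) : R := a (p n)
  have hp (n : ℕ) : (p n).1 = seqProd c n := by
    induction n with
    | zero => rfl
    | succ n ih => rw [seqProd, ← ih]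
  obtain ⟨k, r, hk⟩ := hR c
  obtain ⟨m, hm⟩ := (p (k + 1)).2
  have hu : IsUnit (1 + c (k + 1) * -r) :=
    isUnit_one_add_mul_comm (mem_ringJacobson_iff.1 (ha _) _)
  have h0 : seqProd c (k + 1) * (1 + c (k + 1) * -r) = 0 := by
    rw [mul_add, mul_one, mul_neg, mul_neg, ← mul_assoc]
    exact add_neg_eq_zero.2 hk
  have hp0 : (p (k + 1)).1 = 0 := (hp _).trans (hu.mul_left_eq_zero.1 h0)
  rw [hp0, zero_smul] at hm
  exact hm rfl

lemma PrincipalRightChain.isNilpotent (hR : PrincipalRightChain R) {x : R}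
    (hx : x ∈ Ring.jacobson R) : IsNilpotent x := by
  obtain ⟨k, r, hk⟩ := hR fun _ => x
  have hu : IsUnit (1 + x * -r) := isUnit_one_add_mul_comm (mem_ringJacobson_iff.1 hx _)
  have hpow (n : ℕ) : seqProd (fun _ => x) n = x ^ n := by
    induction n with
    | zero => rw [seqProd, pow_zero]
    | succ n ih => rw [seqProd, ih, pow_succ]
  rw [hpow, hpow] at hk
  refine ⟨k + 1, hu.mul_left_eq_zero.1 ?_⟩
  rw [mul_add, mul_one, mul_neg, mul_neg, ← mul_assoc, ← pow_succ]
  exact add_neg_eq_zero.2 hk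

/-- The chain condition yields minimal elements for divisibility. -/
lemma PrincipalRightChain.exists_minimal (hR : PrincipalRightChain R) (p : R → Prop)
    (hp : ∃ x, p x) : ∃ x, p x ∧ ∀ y, p (x * y) → ∃ r, x = x * y * r := by
  by_contra! h
  choose! y hy hne using h
  obtain ⟨x₀, hx₀⟩ := hp
  let x (n : ℕ) : R := Nat.rec x₀ (fun _ x => x * y x) n
  have hx (n : ℕ) : p (x n) := by
    induction n with
    | zero => exact hx₀
    | succ n ih => exact hy _ ih
  let c (n : ℕ) : R := Nat.casesOn n x₀ fun n => y (x n)
  have hc (n : ℕ) : seqProd c (n + 1) = x n := by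
    induction n with
    | zero => exact one_mul x₀
    | succ n ih => rw [seqProd, ih]
  obtain ⟨k, r, hk⟩ := hR c
  rw [hc, hc] at hk
  exact hne _ (hx k) r hk

/-- A ring with zero Jacobson radical and enough elements minimal for divisibility is
semisimple. -/
lemma isSemisimpleRing_of_exists_minimal (hjac : Ring.jacobson R = ⊥)
    (hmin : ∀ p : R → Prop, (∃ x, p x) → ∃ x, p x ∧ ∀ y, p (y * x) → ∃ r, x = r * (y * x)) :
    IsSemisimpleRing R := by
  let soc : Ideal R := sSup {N : Submodule R R | IsSimpleModule R N}
  obtain ⟨x, hx, hxmin⟩ := hmin (fun x => Ideal.span {x} ⊔ soc = ⊤) ⟨1, by simp⟩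
  refine IsSemisimpleModule.of_sSup_simples_eq_top (R := R) (M := R) ?_
  suffices hx0 : x = 0 by
    rw [hx0, Ideal.span_singleton_eq_bot.2 rfl, bot_sup_eq] at hx
    exact hx
  by_contra hx0
  obtain ⟨z, ⟨hzx, hz0⟩, hzmin⟩ := hmin (fun z => z ∈ Ideal.span {x} ∧ z ≠ 0)
    ⟨x, Ideal.mem_span_singleton_self x, hx0⟩
  obtain ⟨w, rfl⟩ := Ideal.mem_span_singleton'.1 hzx
  have hsimple : IsSimpleModule R (Ideal.span {w * x}) := by
    rw [isSimpleModule_iff_isAtom]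
    refine ⟨fun h => hz0 (Ideal.span_singleton_eq_bot.1 h), fun b hb => ?_⟩
    by_contra hne
    obtain ⟨v, hv, hv0⟩ := Submodule.exists_mem_ne_zero_of_ne_bot hne
    obtain ⟨y, rfl⟩ := Ideal.mem_span_singleton'.1 (hb.le hv)
    obtain ⟨r, hr⟩ := hzmin y ⟨Ideal.mul_mem_left _ _ hzx, hv0⟩
    refine hb.not_ge ((Ideal.span_singleton_le_iff_mem _).2 ?_)
    rw [hr]
    exact Ideal.mul_mem_left _ _ hv
  have hsoc : w * x ∈ soc :=
    (le_sSup (a := Ideal.span {w * x}) hsimple : _ ≤ soc) (Ideal.mem_span_singleton_self _)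
  obtain ⟨m, hm, hzm⟩ : ∃ m : Ideal R, m.IsMaximal ∧ w * x ∉ m := by
    by_contra! h
    refine hz0 ((Submodule.mem_bot R).1 ?_)
    rw [← hjac, Ring.jacobson_eq_sInf_isMaximal]
    exact Submodule.mem_sInf.2 h
  obtain ⟨y, i, hi, hyi⟩ := hm.exists_inv hzm
  have hxi : x * i = (1 - x * y * w) * x := by
    rw [← eq_sub_iff_add_eq'] at hyi
    rw [hyi]; noncomm_ring
  obtain ⟨r, hr⟩ := hxmin (1 - x * y * w) <| by
    rw [← hxi, eq_top_iff, ← hx]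
    refine sup_le ((Ideal.span_singleton_le_iff_mem _).2 ?_) le_sup_right
    have hxe : x * i + x * y * (w * x) = x := by
      rw [hxi]; noncomm_ring
    have := Submodule.add_mem_sup (Ideal.mem_span_singleton_self (x * i))
      (soc.mul_mem_left (x * y) hsoc)
    rwa [hxe] at this
  refine hzm (m.mul_mem_left _ ?_)
  rw [hr, ← hxi]
  exact m.mul_mem_left _ (m.mul_mem_left _ hi)

lemma PrincipalRightChain.isSemisimpleRing_quotient (hR : PrincipalRightChain R) :
    IsSemisimpleRing (R ⧸ Ring.jacobson R) := by
  have hB : PrincipalRightChain (R ⧸ Ring.jacobson R) :=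
    .of_surjective (Ideal.Quotient.mk _) Ideal.Quotient.mk_surjective hR
  rw [← isSemisimpleRing_mulOpposite_iff]
  refine isSemisimpleRing_of_exists_minimal ?_ fun p hp => ?_
  · refine (Submodule.eq_bot_iff _).2 fun x hx => ?_
    have := op_mem_ringJacobson_iff.1 (show op x.unop ∈ _ from hx)
    rw [Ring.jacobson_quotient_jacobson] at this
    exact unop_injective this
  · obtain ⟨x, hx, hmin⟩ := hB.exists_minimal (fun x => p (op x)) ⟨_, hp.choose_spec⟩
    refine ⟨op x, hx, fun y hy => ?_⟩
    obtain ⟨r, hr⟩ := hmin y.unop hy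
    exact ⟨op r, unop_injective hr⟩

/-- Simple modules have projective covers if idempotents lift modulo the radical. -/
lemma exists_cover_of_isSimpleModule [IsSemisimpleRing (R ⧸ Ring.jacobson R)]
    (hnil : ∀ x ∈ Ring.jacobson R, IsNilpotent x) (T : Type u) [AddCommGroup T] [Module R T]
    [IsSimpleModule R T] :
    ∃ (P : Type u) (_ : AddCommGroup P) (_ : Module R P) (f : P →ₗ[R] T),
      Module.Projective R P ∧ Surjective f ∧ LinearMap.ker f ≤ Ring.jacobson R • ⊤ := by
  have := IsSimpleModule.nontrivial R T
  obtain ⟨t, ht⟩ := exists_ne (0 : T)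
  let φ : R →ₗ[R] T := LinearMap.toSpanSingleton R T t
  have hφ : Surjective φ := IsSimpleModule.toSpanSingleton_surjective R ht
  let m : Ideal R := LinearMap.ker φ
  have hm : m.IsMaximal := IsSimpleModule.ker_toSpanSingleton_isMaximal R ht
  have hJm : Ring.jacobson R ≤ m := by
    rw [Ring.jacobson_eq_sInf_isMaximal]
    exact sInf_le hm
  let π := Ideal.Quotient.mk (Ring.jacobson R)
  have hπ : Surjective π := Ideal.Quotient.mk_surjective
  obtain ⟨g, hg, hgm⟩ := IsSemisimpleRing.ideal_eq_span_idempotent (m.map π)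
  obtain ⟨e, he, hge⟩ := exists_isIdempotentElem_eq_of_ker_isNilpotent π
    (fun x hx => hnil x (Ideal.Quotient.eq_zero_iff_mem.1 hx)) (1 - g) (hπ _) hg.one_sub
  let P : Ideal R := Ideal.span {e}
  have hPe (p : R) (hp : p ∈ P) : p * e = p := by
    obtain ⟨r, rfl⟩ := Ideal.mem_span_singleton'.1 hp
    rw [mul_assoc, he.eq]
  have hmem (r : R) (hr : π r ∈ m.map π) : r ∈ m := by
    obtain ⟨s, hs, hsr⟩ := (Ideal.mem_map_iff_of_surjective π hπ).1 hr
    rw [← sub_add_cancel r s]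
    exact m.add_mem (hJm (Ideal.Quotient.eq.1 hsr.symm)) hs
  refine ⟨P, inferInstance, inferInstance, φ ∘ₗ P.subtype, ?_, ?_, ?_⟩
  · let s : R →ₗ[R] P := (LinearMap.toSpanSingleton R R e).codRestrict P fun r =>
      P.mul_mem_left r (Ideal.mem_span_singleton_self e)
    exact Module.Projective.of_split P.subtype s
      (LinearMap.ext fun p => Subtype.ext (hPe p p.2))
  · intro t
    obtain ⟨r, rfl⟩ := hφ t
    refine ⟨⟨r * e, P.mul_mem_left r (Ideal.mem_span_singleton_self e)⟩, ?_⟩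
    have : r - r * e ∈ m := hmem _ <| by
      rw [map_sub, map_mul, hge, mul_sub, mul_one, sub_sub_cancel, hgm]
      exact Ideal.mul_mem_left _ _ (Ideal.mem_span_singleton_self g)
    rw [LinearMap.mem_ker, map_sub, sub_eq_zero] at this
    exact this.symm
  · rintro ⟨p, hp⟩ hpm
    have hpg : π p ∈ m.map π := Ideal.mem_map_of_mem π hpm
    rw [hgm] at hpg
    obtain ⟨s, hs⟩ := Ideal.mem_span_singleton'.1 hpg
    have hpJ : p ∈ Ring.jacobson R := by
      rw [← Ideal.Quotient.eq_zero_iff_mem]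
      change π p = 0
      rw [← hPe p hp, map_mul, hge, ← hs, mul_assoc, mul_sub, mul_one, hg.eq, sub_self, mul_zero]
    have hpe : (⟨p, hp⟩ : P) = p • ⟨e, Ideal.mem_span_singleton_self e⟩ :=
      Subtype.ext (hPe p hp).symm
    rw [hpe]
    exact Submodule.smul_mem_smul hpJ Submodule.mem_top

lemma exists_cover_of_isSemisimpleModule [IsSemisimpleRing (R ⧸ Ring.jacobson R)]
    (hnil : ∀ x ∈ Ring.jacobson R, IsNilpotent x) (M : Type u) [AddCommGroup M] [Module R M]
    [IsSemisimpleModule R M] :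
    ∃ (P : Type u) (_ : AddCommGroup P) (_ : Module R P) (f : P →ₗ[R] M),
      Module.Projective R P ∧ Surjective f ∧ LinearMap.ker f ≤ Ring.jacobson R • ⊤ := by
  classical
  obtain ⟨s, e, hs⟩ := IsSemisimpleModule.exists_linearEquiv_dfinsupp R M
  choose P _ _ f hP hf hker using fun i : s =>
    have := hs.2 i
    exists_cover_of_isSimpleModule hnil (i.1 : Submodule R M)
  let F : (Π₀ i, P i) →ₗ[R] Π₀ i : s, (i.1 : Submodule R M) := DFinsupp.mapRange.linearMap f
  have hF : Surjective F := (DFinsupp.mapRange_surjective _ fun i => map_zero (f i)).2 hf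
  refine ⟨Π₀ i, P i, inferInstance, inferInstance, e.symm.toLinearMap ∘ₗ F, inferInstance,
    e.symm.surjective.comp hF, fun x hx => ?_⟩
  have hx' : F x = 0 := e.symm.injective (hx.trans (map_zero _).symm)
  rw [← DFinsupp.sum_single (f := x)]
  refine Submodule.sum_mem _ fun i _ => ?_
  have hi : x i ∈ Ring.jacobson R • (⊤ : Submodule R (P i)) :=
    hker i (DFunLike.congr_fun hx' i)
  have := Submodule.mem_map_of_mem (f := DFinsupp.lsingle (R := R) i) hi
  rw [Submodule.map_smul''] at this
  exact Submodule.smul_mono le_rfl le_top this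

/-- Bass' theorem: the descending chain condition on principal right ideals implies left
perfectness. -/
theorem PrincipalRightChain.isLeftPerfect (hR : PrincipalRightChain R) : IsLeftPerfect R := by
  intro M _ _
  have := hR.isSemisimpleRing_quotient
  have hJ := hR.nakayamaIdeal
  have := isSemisimpleModule_quotient_smul_top (I := Ring.jacobson R) M
  obtain ⟨P, _, _, f, _, hf, hker⟩ := exists_cover_of_isSemisimpleModule
    (fun x hx => hR.isNilpotent hx) (M ⧸ Ring.jacobson R • (⊤ : Submodule R M))
  let q := (Ring.jacobson R • (⊤ : Submodule R M)).mkQ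
  obtain ⟨g, hg⟩ := Module.projective_lifting_property q f (Submodule.mkQ_surjective _)
  have hg' (p : P) : q (g p) = f p := LinearMap.congr_fun hg p
  refine ⟨P, _, _, g, inferInstance, ?_, fun N hN => hJ.eq_top (eq_top_iff.2 ?_)⟩
  · rw [← LinearMap.range_eq_top]
    refine hJ.eq_top (eq_top_iff.2 fun x _ => ?_)
    obtain ⟨p, hp⟩ := hf (q x)
    rw [← add_sub_cancel (g p) x]
    refine Submodule.add_mem_sup (LinearMap.mem_range_self g p) ?_
    rw [← Submodule.Quotient.mk_eq_zero, ← Submodule.mkQ_apply, map_sub]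
    exact sub_eq_zero.2 (hp.symm.trans (hg' p).symm)
  · refine hN.ge.trans (sup_le_sup_left (fun p hp => hker ?_) N)
    rw [LinearMap.mem_ker, ← hg', LinearMap.mem_ker.1 hp, map_zero]

end Bass

/-! ### Simple modules over semilocal rings -/

section Simple

variable {R : Type u} [Ring R]

/-- If `R` is semisimple modulo its radical, there are finitely many simple modules. -/
lemma finite_of_pairwise_not_linearEquiv [IsSemisimpleRing (R ⧸ Ring.jacobson R)]
    {ι : Type u} (S : ι → Type u) [∀ i, AddCommGroup (S i)] [∀ i, Module R (S i)]
    (hS : ∀ i, IsSimpleModule R (S i)) (hinj : ∀ i j, Nonempty (S i ≃ₗ[R] S j) → i = j) :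
    Finite ι := by
  let X := R ⧸ Ring.jacobson R • (⊤ : Submodule R R)
  have : IsSemisimpleModule R X := isSemisimpleModule_quotient_smul_top R
  have hsub (i : ι) : ∃ K : Submodule R X, Nonempty (S i ≃ₗ[R] K) := by
    have := IsSimpleModule.nontrivial R (S i)
    obtain ⟨s, hs⟩ := exists_ne (0 : S i)
    let φ := LinearMap.toSpanSingleton R (S i) s
    have hφ : Surjective φ := IsSimpleModule.toSpanSingleton_surjective R hs
    have hle : Ring.jacobson R • (⊤ : Submodule R R) ≤ LinearMap.ker φ := by
      refine Submodule.smul_le.2 fun r hr x _ => ?_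
      rw [LinearMap.mem_ker, map_smul]
      exact Module.mem_annihilator.1 (IsSemisimpleModule.jacobson_le_annihilator R (S i) hr) _
    let ψ : X →ₗ[R] S i := Submodule.liftQ _ φ hle
    have hψ : Surjective ψ := fun t => by
      obtain ⟨r, hr⟩ := hφ t
      exact ⟨Submodule.mkQ _ r, hr⟩
    obtain ⟨K, ⟨e⟩⟩ := IsSemisimpleModule.exists_submodule_linearEquiv_quotient (LinearMap.ker ψ)
    exact ⟨K, ⟨(e.trans (ψ.quotKerEquivOfSurjective hψ)).symm⟩⟩
  choose K hK using hsub
  have hsimple (i : ι) : IsSimpleModule R (K i) := IsSimpleModule.congr (hK i).some.symm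
  refine Finite.of_injective
    (fun i => (⟨isotypicComponent R X (K i), K i, hsimple i, rfl⟩ : isotypicComponents R X))
    fun i j hij => hinj i j ?_
  have hle : K i ≤ isotypicComponent R X (K j) :=
    (Submodule.le_isotypicComponent (K i)).trans (congrArg Subtype.val hij).le
  have hsimple' (m : {m : Submodule R X | Nonempty (m ≃ₗ[R] K j)}) : IsSimpleModule R m :=
    IsSimpleModule.congr m.2.some
  obtain ⟨m, ⟨e⟩, ⟨e'⟩⟩ := Submodule.linearEquiv_of_le_sSup _ _ hle
  exact ⟨(hK i).some.trans (e'.trans (e.trans (hK j).some.symm))⟩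

lemma isSemisimpleRing_mulOpposite_quotient [IsSemisimpleRing (R ⧸ Ring.jacobson R)] :
    IsSemisimpleRing (Rᵐᵒᵖ ⧸ Ring.jacobson Rᵐᵒᵖ) := by
  let f : Rᵐᵒᵖ →+* (R ⧸ Ring.jacobson R)ᵐᵒᵖ := (Ideal.Quotient.mk (Ring.jacobson R)).op
  have hf : Surjective f := fun y => by
    obtain ⟨x, hx⟩ := Ideal.Quotient.mk_surjective y.unop
    exact ⟨op x, unop_injective hx⟩
  have hker : RingHom.ker f = Ring.jacobson Rᵐᵒᵖ := by
    ext x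
    rw [RingHom.mem_ker, ← op_unop x, op_mem_ringJacobson_iff, ← Ideal.Quotient.eq_zero_iff_mem]
    exact op_eq_zero_iff _
  exact ((Ideal.quotEquivOfEq hker.symm).trans
    (RingHom.quotientKerEquivOfSurjective hf)).symm.isSemisimpleRing

/-- The Jacobson radical consists of the elements annihilating all simple right modules. -/
lemma mem_ringJacobson_iff_forall_smul_eq_zero {ι : Type u} {S : ι → Type u}
    [∀ i, AddCommGroup (S i)] [∀ i, Module Rᵐᵒᵖ (S i)] (hS : IsSimpleFamily R S) {x : R} :
    x ∈ Ring.jacobson R ↔ ∀ (i : ι) (s : S i), op x • s = 0 := by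
  rw [← op_mem_ringJacobson_iff]
  constructor
  · intro h i s
    have := hS.1 i
    exact Module.mem_annihilator.1 (IsSemisimpleModule.jacobson_le_annihilator Rᵐᵒᵖ (S i) h) s
  · intro h
    rw [Ring.jacobson_eq_sInf_isMaximal]
    refine Submodule.mem_sInf.2 fun (m : Ideal Rᵐᵒᵖ) (hm : m.IsMaximal) => ?_
    obtain ⟨i, ⟨e⟩⟩ := hS.2.1 (Rᵐᵒᵖ ⧸ m) _ _ (isSimpleModule_iff_isCoatom.2 hm.out)
    have h1 : op x • m.mkQ 1 = 0 := by
      refine e.injective ?_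
      rw [map_smul, h, map_zero]
    rw [← map_smul, smul_eq_mul, mul_one, Submodule.mkQ_apply,
      Submodule.Quotient.mk_eq_zero] at h1
    exact h1

end Simple

/-! ### Nakayama's lemma for triangular matrix rings -/

namespace Tri

variable {A B M : Type u} [Ring A] [Ring B] [AddCommGroup M]
  [Module B M] [Module Aᵐᵒᵖ M] [SMulCommClass B Aᵐᵒᵖ M]

/-- The projection onto the upper left corner. -/
def aHom : Tri A B M →+* A where
  toFun := a
  map_one' := rfl
  map_mul' _ _ := rfl
  map_zero' := rfl
  map_add' _ _ := rfl

/-- The projection onto the lower right corner. -/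
def bHom : Tri A B M →+* B where
  toFun := b
  map_one' := rfl
  map_mul' _ _ := rfl
  map_zero' := rfl
  map_add' _ _ := rfl

lemma aHom_surjective : Surjective (aHom : Tri A B M →+* A) := fun a => ⟨⟨a, 0, 0⟩, rfl⟩

/-- Modules on which the lower right idempotent acts as zero are modules over the upper left
corner. -/
lemma subsingleton_of_smul_eq_zero {J : Ideal A} (hJ : NakayamaIdeal J) {I : Ideal (Tri A B M)}
    (hI : ∀ x ∈ I, x.a ∈ J) {Q : Type u} [AddCommGroup Q] [Module (Tri A B M) Q]
    (hQ : ∀ q : Q, (⟨0, 0, 1⟩ : Tri A B M) • q = 0)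
    (htop : I • (⊤ : Submodule (Tri A B M) Q) = ⊤) : Subsingleton Q := by
  have hsmul (x : Tri A B M) (q : Q) : x • q = (⟨x.a, 0, 0⟩ : Tri A B M) • q := by
    have hx : x = ⟨x.a, 0, 0⟩ + ⟨0, 0, 1⟩ * x := by ext <;> simp
    conv_lhs => rw [hx, add_smul, mul_smul, hQ, add_zero]
  let mod : Module A Q :=
    { smul := fun a q => (⟨a, 0, 0⟩ : Tri A B M) • q
      one_smul := fun q => (hsmul 1 q).symm.trans (one_smul _ q)
      mul_smul := fun a a' q => by
        change (⟨a * a', 0, 0⟩ : Tri A B M) • q =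
          (⟨a, 0, 0⟩ : Tri A B M) • (⟨a', 0, 0⟩ : Tri A B M) • q
        rw [← mul_smul, hsmul (_ * _)]
        rfl
      smul_zero := fun a => smul_zero _
      smul_add := fun a => smul_add _
      add_smul := fun a a' q => by
        change (⟨a + a', 0, 0⟩ : Tri A B M) • q =
          (⟨a, 0, 0⟩ : Tri A B M) • q + (⟨a', 0, 0⟩ : Tri A B M) • q
        rw [← add_smul, hsmul (_ + _)]
        rfl
      zero_smul := fun q => zero_smul (Tri A B M) q }
  refine hJ Q (eq_top_iff.2 fun q _ => ?_)
  have hq : q ∈ I • (⊤ : Submodule (Tri A B M) Q) := by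
    rw [htop]; exact Submodule.mem_top
  refine Submodule.smul_induction_on hq (fun x hx n _ => ?_) (fun _ _ => Submodule.add_mem _)
  rw [hsmul]
  exact Submodule.smul_mem_smul (M := Q) (N := ⊤) (hI x hx) Submodule.mem_top

lemma nakayamaIdeal {J : Ideal A} (hJ : NakayamaIdeal J) {I : Ideal (Tri A B M)}
    (hIa : ∀ x ∈ I, x.a ∈ J) (hIb : ∀ x ∈ I, ∀ y ∈ I, x.b * y.b = 0) : NakayamaIdeal I := by
  intro X _ _ hX
  let f : Tri A B M := ⟨0, 0, 1⟩
  have hf : f * f = f := by ext <;> simp [f]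
  have hxf (x : Tri A B M) : x * f = ⟨0, 0, x.b⟩ := by ext <;> simp [f]
  have hfx (x : Tri A B M) : f * (x * f) = x * f := by
    rw [hxf]; ext <;> simp [f]
  let N : Submodule (Tri A B M) X :=
    { carrier := {x | f • x = x}
      zero_mem' := smul_zero f
      add_mem' := fun {x y} (hx : f • x = x) (hy : f • y = y) => by
        change f • (x + y) = x + y
        rw [smul_add, hx, hy]
      smul_mem' := fun r x (hx : f • x = x) => by
        change f • r • x = r • x
        rw [← hx, ← mul_smul, ← mul_smul, mul_assoc, hfx, mul_smul, hx] }
  have hfN (x : X) : f • x ∈ N := by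
    change f • f • x = f • x
    rw [← mul_smul, hf]
  have hmap : I • (⊤ : Submodule (Tri A B M) (X ⧸ N)) = ⊤ := by
    have h := congrArg (Submodule.map N.mkQ) hX
    rwa [Submodule.map_smul'', Submodule.map_top, LinearMap.range_eq_top.2 N.mkQ_surjective] at h
  have hQ : Subsingleton (X ⧸ N) := by
    refine subsingleton_of_smul_eq_zero hJ hIa (fun q => ?_) hmap
    obtain ⟨x, rfl⟩ := N.mkQ_surjective q
    rw [← map_smul, Submodule.mkQ_apply, Submodule.Quotient.mk_eq_zero]
    exact hfN x
  rw [Submodule.Quotient.subsingleton_iff] at hQ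
  have hfX (x : X) : f • x = x := (hQ ▸ Submodule.mem_top : x ∈ N)
  have hzero (x : Tri A B M) (hx : x ∈ I) (q : X) : x • q = 0 := by
    have hq : q ∈ I • (⊤ : Submodule (Tri A B M) X) := by
      rw [hX]; exact Submodule.mem_top
    refine Submodule.smul_induction_on hq (fun y hy n _ => ?_) (fun y z hy hz => ?_)
    · rw [← mul_smul, ← hfX n, ← mul_smul, hxf, mul_b, hIb x hx y hy]
      exact zero_smul (Tri A B M) n
    · rw [smul_add, hy, hz, add_zero]
  refine subsingleton_of_forall_eq 0 fun q => ?_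
  have hq : q ∈ I • (⊤ : Submodule (Tri A B M) X) := by
    rw [hX]; exact Submodule.mem_top
  exact Submodule.smul_induction_on hq (fun x hx n _ => hzero x hx n)
    (fun y z hy hz => by rw [hy, hz, add_zero])

end Tri

/-! ### The asymmetric cover of a perfect ring -/

section AsymCover

variable (A : Type u) [Ring A] {ι : Type u} (S : ι → Type u)
  [∀ i, AddCommGroup (S i)] [∀ i, Module Aᵐᵒᵖ (S i)]

/-- The canonical map from the asymmetric cover to its largest semisimple quotient. -/
def asymCoverToSemisimple : AsymCover A S →+* (A ⧸ Ring.jacobson A) × (∀ i, EndS A S i) :=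
  ((Ideal.Quotient.mk (Ring.jacobson A)).comp Tri.aHom).prod
    ((RingHom.pi fun i => (tszeFst (EndS A S i)).comp (Pi.evalRingHom _ i)).comp Tri.bHom)

lemma asymCoverToSemisimple_surjective : Surjective (asymCoverToSemisimple A S) := by
  rintro ⟨a, b⟩
  obtain ⟨a, rfl⟩ := Ideal.Quotient.mk_surjective a
  exact ⟨⟨a, 0, fun i => TrivSqZeroExt.inl (b i)⟩, rfl⟩

variable {A S}

lemma mem_ker_asymCoverToSemisimple {x : AsymCover A S} :
    x ∈ RingHom.ker (asymCoverToSemisimple A S) ↔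
      x.a ∈ Ring.jacobson A ∧ ∀ i, (x.b i).fst = 0 := by
  rw [RingHom.mem_ker, Prod.ext_iff, ← Ideal.Quotient.eq_zero_iff_mem, ← funext_iff]
  rfl

lemma IsLeftPerfect.projectiveMonoSplit_asymCover (hA : IsLeftPerfect A)
    (hS : IsSimpleFamily A S) : ProjectiveMonoSplit (AsymCover A S) := by
  classical
  have := hA.isSemisimpleRing_quotient
  have hsimple := hS.1
  have := isSemisimpleRing_mulOpposite_quotient (R := A)
  have : Finite ι := finite_of_pairwise_not_linearEquiv S hS.1 hS.2.2
  have (i : ι) : IsSemisimpleRing (EndS A S i) := IsSemisimpleRing.moduleEnd Aᵐᵒᵖ (S i)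
  let I := RingHom.ker (asymCoverToSemisimple A S)
  have : IsSemisimpleRing (AsymCover A S ⧸ I) :=
    (RingHom.quotientKerEquivOfSurjective
      (asymCoverToSemisimple_surjective A S)).symm.isSemisimpleRing
  have hI : NakayamaIdeal I := by
    refine Tri.nakayamaIdeal hA.nakayamaIdeal
      (fun x hx => (mem_ker_asymCoverToSemisimple.1 hx).1) fun x hx y hy => ?_
    funext i
    have hx := (mem_ker_asymCoverToSemisimple.1 hx).2 i
    have hy := (mem_ker_asymCoverToSemisimple.1 hy).2 i
    ext <;> simp [hx, hy]
  intro K P _ _ _ _ _ _ i hi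
  refine exists_retraction_of_injective hI (fun y hy => ?_) i hi
  refine mem_ker_asymCoverToSemisimple.2 ⟨?_, fun i => ?_⟩
  · rw [mem_ringJacobson_iff_forall_smul_eq_zero hS]
    intro i s
    have h := hy ⟨0, DirectSum.of S i s, 0⟩ fun z hz => by
      have hz := (mem_ringJacobson_iff_forall_smul_eq_zero hS).1
        (mem_ker_asymCoverToSemisimple.1 hz).1 i s
      refine Tri.ext (zero_mul _) ?_ (zero_mul _)
      change op z.a • DirectSum.of S i s + (0 : Abar A S) • z.m = 0
      rw [zero_smul, add_zero, ← DirectSum.of_smul, hz, map_zero]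
    have h : op y.a • DirectSum.of S i s + (0 : Abar A S) • y.m = 0 := congrArg Tri.m h
    rw [zero_smul, add_zero, ← DirectSum.of_smul] at h
    exact DirectSum.of_injective (β := S) i (h.trans (map_zero _).symm)
  · let ε : Abar A S := Pi.single i (TrivSqZeroExt.inr 1)
    have hε (j : ι) : (ε j).fst = 0 := by
      by_cases hj : j = i
      · subst hj; simp [ε]
      · simp [ε, hj]
    have h := hy ⟨0, 0, ε⟩ fun z hz => by
      have hz := (mem_ker_asymCoverToSemisimple.1 hz).2
      refine Tri.ext (zero_mul _) ?_ ?_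
      · change op z.a • (0 : Sbar A S) + ε • z.m = 0
        rw [smul_zero, zero_add]
        refine DFinsupp.ext fun j => ?_
        rw [DirectSum.smul_apply, abar_smul_def, hε, LinearMap.zero_apply]
        rfl
      · change ε * z.b = 0
        funext j
        by_cases hj : j = i
        · subst hj
          ext <;> simp [ε, hz]
        · simp [ε, hj]
    have h := congrArg (fun x : AsymCover A S => (x.b i).snd) h
    simpa [ε] using h

end AsymCover

/-- For a ring `A` with asymmetric cover
`Ã = [[A,0],[S̄,Ā]]`, the big finitistic dimension of the opposite ring `Ã^op`
vanishes if and only if `A` is left perfect. -/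
theorem bigFinDim_op_asymCover_eq_zero_iff_leftPerfect
    (A : Type u) [Ring A] {ι : Type u} (S : ι → Type u)
    [∀ i, AddCommGroup (S i)] [∀ i, Module Aᵐᵒᵖ (S i)]
    (hfam : IsSimpleFamily A S) :
    bigFinDim (AsymCover A S)ᵐᵒᵖ = 0 ↔ IsLeftPerfect A := by
  rw [bigFinDim_mulOpposite_eq_zero_iff]
  exact ⟨fun h => (h.principalRightChain.of_surjective Tri.aHom Tri.aHom_surjective).isLeftPerfect,
    fun h => h.projectiveMonoSplit_asymCover hfam⟩
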